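/- arXiv:0709.1589 — 2 statements merged into one kernel-verified Lean document; each statement's English description precedes it below -/
import Mathlib

section
/- Mixed stopping times are essential for the seller's price representation: there exist a positive integer T, a finite probability space Ω with a filtration {∅,Ω} = F_0 ⊆ ... ⊆ F_T = 2^Ω, adapted bid and ask processes with 0 < S^b_t ≤ S^a_t, admitting a probability measure P with P{ω} > 0 for all ω and a P-martingale S with S^b ≤ S ≤ S^a (so the model is arbitrage-free), and an adapted ℝ²-valued payoff process (ξ,ζ), such that π^a(ξ,ζ) > sup over pure stopping times τ of sup over (P,S) ∈ barP(τ) of E_P(ξ_τ + S_τ ζ_τ). -/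
open MeasureTheory
open scoped Pointwise

noncomputable section

namespace RZ

variable {Ω : Type*} [Fintype Ω]

/-- `ω` and `ω'` lie in the same atom of the σ-field `m`. -/
def sameAtom (m : MeasurableSpace Ω) (ω ω' : Ω) : Prop :=
  ∀ A : Set Ω, MeasurableSet[m] A → (ω ∈ A ↔ ω' ∈ A)

/-- Elementary conditional expectation w.r.t. a σ-field on a finite space:
at `ω` it is the `P`-average of `f` over the atom of `ω`. -/
def condExp (m : MeasurableSpace Ω) (P : Ω → ℝ) (f : Ω → ℝ) (ω : Ω) : ℝ :=
  (∑ ω' : Ω, Set.indicator {ω'' | sameAtom m ω ω''} (fun ω'' => P ω'' * f ω'') ω') /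
  (∑ ω' : Ω, Set.indicator {ω'' | sameAtom m ω ω''} P ω')

/-- Expectation under `P`. -/
def expect (P : Ω → ℝ) (f : Ω → ℝ) : ℝ := ∑ ω : Ω, P ω * f ω

/-- Discrete market model with proportional transaction costs. -/
structure Market (Ω : Type*) [Fintype Ω] where
  T : ℕ
  T_pos : 0 < T
  F : ℕ → MeasurableSpace Ω
  F_mono : ∀ ⦃s t : ℕ⦄, s ≤ t → F s ≤ F t
  F_zero : F 0 = ⊥
  F_top : F T = ⊤
  Q : Ω → ℝ
  Q_pos : ∀ ω, 0 < Q ω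
  Q_sum : ∑ ω, Q ω = 1
  Sb : ℕ → Ω → ℝ
  Sa : ℕ → Ω → ℝ
  Sb_pos : ∀ t ω, t ≤ T → 0 < Sb t ω
  Sb_le_Sa : ∀ t ω, t ≤ T → Sb t ω ≤ Sa t ω
  Sb_adapted : ∀ t, t ≤ T → Measurable[F t] (Sb t)
  Sa_adapted : ∀ t, t ≤ T → Measurable[F t] (Sa t)

variable (M : Market Ω)

/-- Liquidation value θ_t(γ, δ) in scenario ω, for a cash position γ and stock position δ. -/
def liq (t : ℕ) (ω : Ω) (γ δ : ℝ) : ℝ :=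
  γ + M.Sb t ω * max δ 0 - M.Sa t ω * max (-δ) 0

/-- An adapted (real-valued) process. -/
def IsAdapted (X : ℕ → Ω → ℝ) : Prop := ∀ t, t ≤ M.T → Measurable[M.F t] (X t)

/-- An adapted ℝ²-valued payoff process. -/
def AdaptedPair (ξ ζ : ℕ → Ω → ℝ) : Prop := IsAdapted M ξ ∧ IsAdapted M ζ

/-- Self-financing strategy. -/
def SelfFinancing (α β : ℕ → Ω → ℝ) : Prop :=
  Measurable[M.F 0] (α 0) ∧ Measurable[M.F 0] (β 0) ∧
  (∀ t, t < M.T → Measurable[M.F t] (α (t + 1)) ∧ Measurable[M.F t] (β (t + 1))) ∧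
  (∀ t, t < M.T → ∀ ω, 0 ≤ liq M t ω (α t ω - α (t + 1) ω) (β t ω - β (t + 1) ω))

/-- Pure stopping time with values in {0,...,T}. -/
def IsStop (τ : Ω → ℕ) : Prop :=
  (∀ ω, τ ω ≤ M.T) ∧ ∀ t : ℕ, MeasurableSet[M.F t] {ω | τ ω = t}

/-- Seller superhedging strategy. -/
def SellerHedge (ξ ζ α β : ℕ → Ω → ℝ) : Prop :=
  SelfFinancing M α β ∧
  ∀ τ, IsStop M τ → ∀ ω,
    0 ≤ liq M (τ ω) ω (α (τ ω) ω - ξ (τ ω) ω) (β (τ ω) ω - ζ (τ ω) ω)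

/-- Buyer superhedging strategy. -/
def BuyerHedge (ξ ζ α β : ℕ → Ω → ℝ) : Prop :=
  SelfFinancing M α β ∧
  ∃ τ, IsStop M τ ∧ ∀ ω,
    0 ≤ liq M (τ ω) ω (α (τ ω) ω + ξ (τ ω) ω) (β (τ ω) ω + ζ (τ ω) ω)

/-- Seller's (ask) price: infimum of the initial costs of seller superhedging strategies. -/
def askPrice (ξ ζ : ℕ → Ω → ℝ) : ℝ :=
  sInf {x | ∃ α β, SellerHedge M ξ ζ α β ∧ ∀ ω, x = -liq M 0 ω (-α 0 ω) (-β 0 ω)}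

/-- Buyer's (bid) price: supremum of the amounts raised by buyer superhedging strategies. -/
def bidPrice (ξ ζ : ℕ → Ω → ℝ) : ℝ :=
  sSup {x | ∃ α β, BuyerHedge M ξ ζ α β ∧ ∀ ω, x = liq M 0 ω (-α 0 ω) (-β 0 ω)}

/-- Mixed stopping time. -/
def IsMixedStop (χ : ℕ → Ω → ℝ) : Prop :=
  (∀ t, t ≤ M.T → Measurable[M.F t] (χ t)) ∧ (∀ t ω, 0 ≤ χ t ω) ∧
  ∀ ω, ∑ t ∈ Finset.range (M.T + 1), χ t ω = 1

/-- χ*_t = Σ_{s=t}^T χ_s  (so χ*_{T+1} = 0). -/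
def chiStar (χ : ℕ → Ω → ℝ) (t : ℕ) (ω : Ω) : ℝ := ∑ s ∈ Finset.Icc t M.T, χ s ω

/-- Z^{χ*}_t = Σ_{s=t}^T χ_s Z_s  (so Z^{χ*}_{T+1} = 0). -/
def starVal (χ Z : ℕ → Ω → ℝ) (t : ℕ) (ω : Ω) : ℝ :=
  ∑ s ∈ Finset.Icc t M.T, χ s ω * Z s ω

/-- Z_χ = Σ_{t=0}^T χ_t Z_t. -/
def mixVal (χ Z : ℕ → Ω → ℝ) (ω : Ω) : ℝ :=
  ∑ t ∈ Finset.range (M.T + 1), χ t ω * Z t ω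

/-- Membership in the family barP(χ). -/
def memBarP (χ : ℕ → Ω → ℝ) (P : Ω → ℝ) (S : ℕ → Ω → ℝ) : Prop :=
  (∀ ω, 0 ≤ P ω) ∧ (∑ ω, P ω) = 1 ∧ IsAdapted M S ∧
  (∀ t ω, t ≤ M.T → M.Sb t ω ≤ S t ω ∧ S t ω ≤ M.Sa t ω) ∧
  (∀ t, t ≤ M.T → ∀ ω, 0 < P ω →
    chiStar M χ (t + 1) ω * M.Sb t ω ≤ condExp (M.F t) P (starVal M χ S (t + 1)) ω ∧
    condExp (M.F t) P (starVal M χ S (t + 1)) ω ≤ chiStar M χ (t + 1) ω * M.Sa t ω)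

/-- Membership in the family P(χ): barP(χ) with P equivalent to Q. -/
def memP (χ : ℕ → Ω → ℝ) (P : Ω → ℝ) (S : ℕ → Ω → ℝ) : Prop :=
  memBarP M χ P S ∧ ∀ ω, 0 < P ω

/-- The mixed stopping time χ^τ associated with a pure stopping time τ. -/
def pureChi (τ : Ω → ℕ) : ℕ → Ω → ℝ := fun t ω => if τ ω = t then 1 else 0

/-- Arbitrage-free: there is an equivalent probability measure and a martingale
between the bid and ask prices. -/
def ArbitrageFree : Prop :=
  ∃ (P : Ω → ℝ) (S : ℕ → Ω → ℝ),
    (∀ ω, 0 < P ω) ∧ (∑ ω, P ω) = 1 ∧ IsAdapted M S ∧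
    (∀ t ω, t ≤ M.T → M.Sb t ω ≤ S t ω ∧ S t ω ≤ M.Sa t ω) ∧
    (∀ t, t < M.T → ∀ ω, 0 < P ω → condExp (M.F t) P (S (t + 1)) ω = S t ω)

/-- Epigraph of a function ℝ → ℝ, as a subset of ℝ² (first coordinate dominates). -/
def epi (f : ℝ → ℝ) : Set (ℝ × ℝ) := {p | f p.2 ≤ p.1}

/-- The function h_{[b,a]}(y) = a y⁻ − b y⁺. -/
def hfun (b a : ℝ) (y : ℝ) : ℝ := a * max (-y) 0 - b * max y 0

/-- Seller's payoff function u_t(y) = ξ_t + (y − ζ_t)⁻ S^a_t − (y − ζ_t)⁺ S^b_t. -/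
def uSell (ξ ζ : ℕ → Ω → ℝ) (t : ℕ) (ω : Ω) (y : ℝ) : ℝ :=
  ξ t ω + M.Sa t ω * max (ζ t ω - y) 0 - M.Sb t ω * max (y - ζ t ω) 0

/-- Buyer's payoff function u_t(y) = −ξ_t + (y + ζ_t)⁻ S^a_t − (y + ζ_t)⁺ S^b_t. -/
def uBuy (ξ ζ : ℕ → Ω → ℝ) (t : ℕ) (ω : Ω) (y : ℝ) : ℝ :=
  -ξ t ω + M.Sa t ω * max (-(y + ζ t ω)) 0 - M.Sb t ω * max (y + ζ t ω) 0

/-- The seller's pricing recursion: one function per atom,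
`z_T = u_T` and `epi z_{t-1} = epi u_{t-1} ∩ (epi h + ⋂_{succ} epi z_t)`. -/
def SellerRec (ξ ζ : ℕ → Ω → ℝ) (z : ℕ → Ω → ℝ → ℝ) : Prop :=
  (∀ t ω ω', t ≤ M.T → sameAtom (M.F t) ω ω' → z t ω = z t ω') ∧
  (∀ ω, z M.T ω = uSell M ξ ζ M.T ω) ∧
  (∀ t ω, t < M.T →
    epi (z t ω) = epi (uSell M ξ ζ t ω) ∩
      (epi (hfun (M.Sb t ω) (M.Sa t ω)) +
        ⋂ ω' ∈ {ω'' | sameAtom (M.F t) ω ω''}, epi (z (t + 1) ω')))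

/-- The buyer's pricing recursion: one function per atom,
`z_T = u_T` and `epi z_{t-1} = epi u_{t-1} ∪ (epi h + ⋂_{succ} epi z_t)`. -/
def BuyerRec (ξ ζ : ℕ → Ω → ℝ) (z : ℕ → Ω → ℝ → ℝ) : Prop :=
  (∀ t ω ω', t ≤ M.T → sameAtom (M.F t) ω ω' → z t ω = z t ω') ∧
  (∀ ω, z M.T ω = uBuy M ξ ζ M.T ω) ∧
  (∀ t ω, t < M.T →
    epi (z t ω) = epi (uBuy M ξ ζ t ω) ∪
      (epi (hfun (M.Sb t ω) (M.Sa t ω)) +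
        ⋂ ω' ∈ {ω'' | sameAtom (M.F t) ω ω''}, epi (z (t + 1) ω')))

/-- A one-scenario market with bid-ask spreads `[2, 2]`, `[1, 3]`, `[1, 3]`. -/
def spreadMarket : Market Unit where
  T := 2
  T_pos := by norm_num
  F := fun _ => ⊤
  F_mono := fun _ _ _ => le_rfl
  F_zero := by
    refine le_antisymm (fun A _ => ?_) bot_le
    exact MeasurableSpace.measurableSet_bot_iff.2 (A.eq_empty_or_nonempty.imp_right Set.Nonempty.eq_univ)
  F_top := rfl
  Q := fun _ => 1
  Q_pos := fun _ => one_pos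
  Q_sum := by simp
  Sb := fun t _ => if t = 0 then 2 else 1
  Sa := fun t _ => if t = 0 then 2 else 3
  Sb_pos := fun t _ _ => by split_ifs <;> norm_num
  Sb_le_Sa := fun t _ _ => by split_ifs <;> norm_num
  Sb_adapted := fun _ _ => measurable_from_top
  Sa_adapted := fun _ _ => measurable_from_top

/-- Cash part of the option paying `2 - S` at time `1` and `S - 2` at time `2`. -/
def spreadCash (t : ℕ) (_ : Unit) : ℝ := if t = 0 then 0 else if t = 1 then 2 else -2

/-- Stock part of the option paying `2 - S` at time `1` and `S - 2` at time `2`. -/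
def spreadStock (t : ℕ) (_ : Unit) : ℝ := if t = 0 then 0 else if t = 1 then -1 else 1

lemma condExp_unit (m : MeasurableSpace Unit) (P f : Unit → ℝ) (hP : P () = 1) :
    condExp m P f () = f () := by
  have h : sameAtom m () () := fun _ _ => Iff.rfl
  simp [condExp, h, hP]

lemma isAdapted_spreadMarket (X : ℕ → Unit → ℝ) : IsAdapted spreadMarket X :=
  fun _ _ => measurable_from_top

lemma arbitrageFree_spreadMarket : ArbitrageFree spreadMarket := by
  refine ⟨fun _ => 1, fun _ _ => 2, fun _ => one_pos, by simp, isAdapted_spreadMarket _,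
    fun t _ _ => ?_, fun t _ _ _ => condExp_unit _ _ _ rfl⟩
  dsimp only [spreadMarket]
  constructor <;> split_ifs <;> norm_num

lemma expect_spread_nonpos {τ : Unit → ℕ} {P : Unit → ℝ} {S : ℕ → Unit → ℝ}
    (hτ : IsStop spreadMarket τ) (h : memBarP spreadMarket (pureChi τ) P S) :
    expect P (fun ω => spreadCash (τ ω) ω + S (τ ω) ω * spreadStock (τ ω) ω) ≤ 0 := by
  obtain ⟨-, hsum, -, -, hmart⟩ := h
  have hP : P () = 1 := by simpa using hsum
  have hle : τ () ≤ 2 := hτ.1 ()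
  obtain ⟨h1, h2⟩ := hmart 0 (Nat.zero_le _) () (by rw [hP]; exact one_pos)
  rw [condExp_unit _ _ _ hP] at h1 h2
  have hIcc : Finset.Icc 1 2 = ({1, 2} : Finset ℕ) := rfl
  simp only [chiStar, starVal, spreadMarket, pureChi, zero_add, if_true, hIcc] at h1 h2
  simp only [expect, Finset.univ_unique, Finset.sum_singleton, PUnit.default_eq_unit, hP]
  generalize τ () = n at *
  interval_cases n <;> simp [spreadCash, spreadStock] at * <;> linarith

lemma liq_nonneg_iff (t : ℕ) (γ δ : ℝ) :
    0 ≤ liq spreadMarket (t + 1) () γ δ ↔ 0 ≤ γ + δ ∧ 0 ≤ γ + 3 * δ := by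
  have h : liq spreadMarket (t + 1) () γ δ = γ + 1 * max δ 0 - 3 * max (-δ) 0 := rfl
  rw [h]
  rcases le_total δ 0 with hδ | hδ
  · rw [max_eq_right hδ, max_eq_left (neg_nonneg.2 hδ)]
    constructor
    · intro h; constructor <;> linarith
    · rintro ⟨h, h'⟩; linarith
  · rw [max_eq_left hδ, max_eq_right (neg_nonpos.2 hδ)]
    constructor
    · intro h; constructor <;> linarith
    · rintro ⟨h, h'⟩; linarith

lemma liq_zero (γ δ : ℝ) : liq spreadMarket 0 () γ δ = γ + 2 * δ := by
  have h : liq spreadMarket 0 () γ δ = γ + 2 * max δ 0 - 2 * max (-δ) 0 := rfl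
  rw [h]
  rcases le_total δ 0 with hδ | hδ
  · rw [max_eq_right hδ, max_eq_left (neg_nonneg.2 hδ)]; ring
  · rw [max_eq_left hδ, max_eq_right (neg_nonpos.2 hδ)]; ring

lemma isStop_const {n : ℕ} (hn : n ≤ 2) : IsStop spreadMarket (fun _ => n) :=
  ⟨fun _ => hn, fun _ => MeasurableSpace.measurableSet_top⟩

lemma one_le_of_sellerHedge {α β : ℕ → Unit → ℝ}
    (h : SellerHedge spreadMarket spreadCash spreadStock α β) :
    1 ≤ -liq spreadMarket 0 () (-α 0 ()) (-β 0 ()) := by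
  obtain ⟨⟨-, -, -, hsf⟩, hhedge⟩ := h
  have h0 := hsf 0 (by norm_num [spreadMarket]) ()
  have h1 := (liq_nonneg_iff 0 _ _).1 (hsf 1 (by norm_num [spreadMarket]) ())
  have e1 := (liq_nonneg_iff 0 _ _).1 (hhedge (fun _ => 1) (isStop_const (by norm_num)) ())
  have e2 := (liq_nonneg_iff 1 _ _).1 (hhedge (fun _ => 2) (isStop_const le_rfl) ())
  rw [liq_zero] at h0 ⊢
  norm_num [spreadCash, spreadStock] at h0 h1 e1 e2
  linarith [e1.1, e2.2, h1.2]

lemma sellerHedge_const :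
    SellerHedge spreadMarket spreadCash spreadStock (fun _ _ => 10) (fun _ _ => 0) := by
  refine ⟨⟨measurable_const, measurable_const, fun _ _ => ⟨measurable_const, measurable_const⟩,
    fun t _ _ => by simp [liq]⟩, fun τ hτ ω => ?_⟩
  have hle : τ () ≤ 2 := hτ.1 ()
  change 0 ≤ liq spreadMarket (τ ()) () (10 - spreadCash (τ ()) ()) (0 - spreadStock (τ ()) ())
  generalize τ () = n at hle
  interval_cases n
  · rw [liq_zero]; norm_num [spreadCash, spreadStock]
  · rw [liq_nonneg_iff 0]; norm_num [spreadCash, spreadStock]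
  · rw [liq_nonneg_iff 1]; norm_num [spreadCash, spreadStock]

/-- Mixed stopping times are essential: there is an arbitrage-free model and an
American option whose seller's price strictly exceeds the supremum over pure stopping
times τ and (P,S) ∈ barP(τ) of E_P(ξ_τ + S_τ ζ_τ). -/
theorem mixed_stopping_times_essential :
    ∃ (Ω' : Type) (_ : Fintype Ω') (M : Market Ω') (ξ ζ : ℕ → Ω' → ℝ),
      AdaptedPair M ξ ζ ∧ ArbitrageFree M ∧
      sSup {x | ∃ τ P S, IsStop M τ ∧ memBarP M (pureChi τ) P S ∧
          x = expect P (fun ω => ξ (τ ω) ω + S (τ ω) ω * ζ (τ ω) ω)} <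
        askPrice M ξ ζ := by
  refine ⟨Unit, inferInstance, spreadMarket, spreadCash, spreadStock,
    ⟨isAdapted_spreadMarket _, isAdapted_spreadMarket _⟩, arbitrageFree_spreadMarket, ?_⟩
  refine lt_of_le_of_lt (b := (0 : ℝ)) (Real.sSup_le ?_ le_rfl)
    (lt_of_lt_of_le one_pos (le_csInf ?_ ?_))
  · rintro x ⟨τ, P, S, hτ, hP, rfl⟩
    exact expect_spread_nonpos hτ hP
  · exact ⟨-liq spreadMarket 0 () (-10) (-0), _, _, sellerHedge_const, fun _ => rfl⟩
  · rintro x ⟨α, β, h, hx⟩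
    rw [hx ()]
    exact one_le_of_sellerHedge h

end RZ
end
end

section
/- Let (α,β) be a self-financing strategy, χ a mixed stopping time, and (P,S) ∈ barP(χ). Then for every t = 0,...,T−1 one has, P-almost surely, E_P(χ*_{t+1} α_t + S^{χ*}_{t+1} β_t | F_t) ≥ E_P(χ*_{t+1} α_{t+1} + S^{χ*}_{t+1} β_{t+1} | F_t). -/
open MeasureTheory
open scoped Pointwise

noncomputable section

namespace RZ

variable {Ω : Type*} [Fintype Ω]

variable (M : Market Ω)

omit [Fintype Ω] in
theorem sameAtom_refl (m : MeasurableSpace Ω) (ω : Ω) : sameAtom m ω ω := fun _ _ => Iff.rfl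

omit [Fintype Ω] in
theorem sameAtom.apply_eq {m : MeasurableSpace Ω} {ω ω' : Ω} (h : sameAtom m ω ω')
    {f : Ω → ℝ} (hf : Measurable[m] f) : f ω' = f ω :=
  (h (f ⁻¹' {f ω}) (hf (measurableSet_singleton _))).1 rfl

theorem sum_indicator_sameAtom_pos (m : MeasurableSpace Ω) {P : Ω → ℝ} (hP : ∀ ω, 0 ≤ P ω)
    {ω : Ω} (hω : 0 < P ω) : 0 < ∑ ω' : Ω, Set.indicator {ω'' | sameAtom m ω ω''} P ω' := by
  refine Finset.sum_pos' (fun i _ => Set.indicator_nonneg (fun x _ => hP x) i)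
    ⟨ω, Finset.mem_univ _, ?_⟩
  rwa [Set.indicator_of_mem (show ω ∈ {ω'' | sameAtom m ω ω''} from sameAtom_refl m ω)]

/-- Measurable factors can be taken out of the conditional expectation. -/
theorem condExp_add_mul_of_measurable {m : MeasurableSpace Ω} {P : Ω → ℝ} (hP : ∀ ω, 0 ≤ P ω)
    {ω : Ω} (hω : 0 < P ω) {c a b : Ω → ℝ} (f : Ω → ℝ)
    (hc : Measurable[m] c) (ha : Measurable[m] a) (hb : Measurable[m] b) :
    condExp m P (fun ω' => c ω' * a ω' + f ω' * b ω') ω =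
      c ω * a ω + condExp m P f ω * b ω := by
  have hpos := sum_indicator_sameAtom_pos m hP hω
  unfold condExp
  rw [div_mul_eq_mul_div, ← sub_eq_iff_eq_add, eq_comm, eq_sub_iff_add_eq,
    eq_div_iff hpos.ne', add_mul, div_mul_cancel₀ _ hpos.ne', Finset.sum_mul, Finset.mul_sum,
    ← Finset.sum_add_distrib]
  refine Finset.sum_congr rfl fun ω' _ => ?_
  by_cases h : sameAtom m ω ω'
  · simp only [Set.indicator, Set.mem_ofPred_eq, h, if_true, h.apply_eq hc, h.apply_eq ha,
      h.apply_eq hb]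
    ring
  · simp [Set.indicator, h]

theorem chiStar_nonneg {χ : ℕ → Ω → ℝ} (hχ : IsMixedStop M χ) (t : ℕ) (ω : Ω) :
    0 ≤ chiStar M χ t ω :=
  Finset.sum_nonneg fun s _ => hχ.2.1 s ω

/-- The tail `χ*_{t+1}` of a mixed stopping time is predictable. -/
theorem measurable_chiStar_succ {χ : ℕ → Ω → ℝ} (hχ : IsMixedStop M χ) {t : ℕ} (ht : t < M.T) :
    Measurable[M.F t] (chiStar M χ (t + 1)) := by
  have heq : chiStar M χ (t + 1) = fun ω => 1 - ∑ s ∈ Finset.range (t + 1), χ s ω := by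
    funext ω
    rw [← hχ.2.2 ω, ← Finset.sum_range_add_sum_Ico _ (by omega : t + 1 ≤ M.T + 1),
      add_sub_cancel_left]
    rfl
  rw [heq]
  refine measurable_const.sub (Finset.measurable_sum _ fun s hs => ?_)
  have hst : s ≤ t := Nat.lt_succ_iff.1 (Finset.mem_range.1 hs)
  exact (hχ.1 s (hst.trans ht.le)).mono (M.F_mono hst) le_rfl

theorem SelfFinancing.measurable {α β : ℕ → Ω → ℝ} (h : SelfFinancing M α β) {t : ℕ}
    (ht : t < M.T) : Measurable[M.F t] (α t) ∧ Measurable[M.F t] (β t) := by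
  cases t with
  | zero => exact ⟨h.1, h.2.1⟩
  | succ s =>
    obtain ⟨hα, hβ⟩ := h.2.2.1 s (Nat.lt_of_succ_lt ht)
    have hle := M.F_mono s.le_succ
    exact ⟨hα.mono hle le_rfl, hβ.mono hle le_rfl⟩

/-- A scaled price `e` between `c * S^b` and `c * S^a` values a position at least at `c` times its
liquidation value. -/
theorem mul_liq_le {t : ℕ} {ω : Ω} {c e : ℝ} (hb : c * M.Sb t ω ≤ e) (ha : e ≤ c * M.Sa t ω)
    (γ δ : ℝ) : c * liq M t ω γ δ ≤ c * γ + e * δ := by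
  have hδ : δ = max δ 0 - max (-δ) 0 :=
    (max_zero_sub_max_neg_zero_eq_self δ).symm
  have h1 := mul_le_mul_of_nonneg_right hb (le_max_right δ 0)
  have h2 := mul_le_mul_of_nonneg_right ha (le_max_right (-δ) 0)
  have h3 : e * δ = e * max δ 0 - e * max (-δ) 0 := by rw [← mul_sub, ← hδ]
  unfold liq
  linarith

/-- One-step supermartingale inequality: for a self-financing (α,β), a mixed stopping
time χ and (P,S) ∈ barP(χ), E_P(χ*_{t+1} α_t + S^{χ*}_{t+1} β_t | F_t) ≥
E_P(χ*_{t+1} α_{t+1} + S^{χ*}_{t+1} β_{t+1} | F_t) P-a.s. -/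
theorem selffinancing_one_step_inequality (α β : ℕ → Ω → ℝ)
    (hsf : SelfFinancing M α β) (χ : ℕ → Ω → ℝ) (hχ : IsMixedStop M χ)
    (P : Ω → ℝ) (S : ℕ → Ω → ℝ) (hPS : memBarP M χ P S) :
    ∀ t, t < M.T → ∀ ω, 0 < P ω →
      condExp (M.F t) P
          (fun ω' => chiStar M χ (t + 1) ω' * α (t + 1) ω' +
            starVal M χ S (t + 1) ω' * β (t + 1) ω') ω ≤
        condExp (M.F t) P
          (fun ω' => chiStar M χ (t + 1) ω' * α t ω' +
            starVal M χ S (t + 1) ω' * β t ω') ω := by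
  intro t ht ω hω
  obtain ⟨hP, -, -, -, hbd⟩ := hPS
  obtain ⟨hb, ha⟩ := hbd t ht.le ω hω
  obtain ⟨hα, hβ⟩ := hsf.measurable M ht
  obtain ⟨hα', hβ'⟩ := hsf.2.2.1 t ht
  have hc := measurable_chiStar_succ M hχ ht
  rw [condExp_add_mul_of_measurable hP hω _ hc hα' hβ',
    condExp_add_mul_of_measurable hP hω _ hc hα hβ]
  have h := (mul_nonneg (chiStar_nonneg M hχ (t + 1) ω) (hsf.2.2.2 t ht ω)).trans
    (mul_liq_le M hb ha _ _)
  linarith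

end RZ
end
end
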